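/- arXiv:2303.10711 — 3 statements merged into one kernel-verified Lean document; each statement's English description precedes it below -/
import Mathlib

section
/- Let k ≥ 1 and fix i ∈ {1,…,k} and a sign e ∈ {0,1}. Identifying a structure for L = {U_1,…,U_k} on the universe {1,…,n} with a k-tuple (W_1,…,W_k) of subsets of Fin n, the fraction of such k-tuples for which 2·|W_i^e| > n (out of all (2^n)^k tuples) tends to 1/2 as n → ∞. That is, for any basic property φ_{s̄,e}(x) with s̄ a 1-subsequence (i.e., for U_i(x) or ¬U_i(x)), the typicality degree d(φ_{s̄,e} : typ) = 1/2; in particular the 0-1 law for typicality degrees fails for relational languages containing unary predicates. -/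
/-- Complementation pairs the subsets of `Fin n` with more than `n / 2` elements with those that
have fewer, leaving only the ties. -/
theorem two_mul_card_majority_add_card_tie (n : ℕ) :
    2 * (Finset.univ.filter fun S : Finset (Fin n) => n < 2 * S.card).card
      + (Finset.univ.filter fun S : Finset (Fin n) => 2 * S.card = n).card = 2 ^ n := by
  have hcompl : (Finset.univ.filter fun S : Finset (Fin n) => 2 * S.card < n).card
      = (Finset.univ.filter fun S : Finset (Fin n) => n < 2 * S.card).card := by
    refine Finset.card_bij' (fun S _ => Sᶜ) (fun S _ => Sᶜ) ?_ ?_ ?_ ?_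
    · intro S
      have := S.card_le_univ
      simp only [Finset.mem_filter, Finset.mem_univ, true_and, Finset.card_compl,
        Fintype.card_fin] at *
      omega
    · intro S
      have := S.card_le_univ
      simp only [Finset.mem_filter, Finset.mem_univ, true_and, Finset.card_compl,
        Fintype.card_fin] at *
      omega
    · simp
    · simp
  have htotal : (Finset.univ : Finset (Finset (Fin n))).card = 2 ^ n := by simp
  have hsplit := Finset.card_filter_add_card_filter_not (s := Finset.univ)
    (fun S : Finset (Fin n) => n < 2 * S.card)
  have hsplit' := Finset.card_filter_add_card_filter_not
    (s := Finset.univ.filter fun S : Finset (Fin n) => ¬ n < 2 * S.card)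
    (fun S : Finset (Fin n) => 2 * S.card < n)
  rw [Finset.filter_filter, Finset.filter_filter,
    Finset.filter_congr (q := fun S : Finset (Fin n) => 2 * S.card < n) (by intros; omega),
    Finset.filter_congr (p := fun S : Finset (Fin n) => ¬ n < 2 * S.card ∧ ¬ 2 * S.card < n)
      (q := fun S : Finset (Fin n) => 2 * S.card = n) (by intros; omega)] at hsplit'
  omega

theorem centralBinom_sq_mul_le (m : ℕ) : m.centralBinom ^ 2 * (2 * m + 1) ≤ 16 ^ m := by
  induction m with
  | zero => simp
  | succ m ih =>
    have h := Nat.succ_mul_centralBinom_succ m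
    refine le_of_mul_le_mul_left ?_ (show 0 < (m + 1) ^ 2 by positivity)
    calc (m + 1) ^ 2 * ((m + 1).centralBinom ^ 2 * (2 * (m + 1) + 1))
        = ((m + 1) * (m + 1).centralBinom) ^ 2 * (2 * m + 3) := by ring
      _ = 4 * ((2 * m + 1) * (2 * m + 3)) * (m.centralBinom ^ 2 * (2 * m + 1)) := by
          rw [h]; ring
      _ ≤ 4 * (4 * (m + 1) ^ 2) * 16 ^ m := by
          exact Nat.mul_le_mul (Nat.mul_le_mul_left 4 (by nlinarith)) ih
      _ = (m + 1) ^ 2 * 16 ^ (m + 1) := by ring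

theorem card_tie_sq_mul_le (n : ℕ) :
    (Finset.univ.filter fun S : Finset (Fin n) => 2 * S.card = n).card ^ 2 * (n + 1) ≤ 4 ^ n := by
  rcases Nat.even_or_odd' n with ⟨m, rfl | rfl⟩
  · have hcard : (Finset.univ.filter fun S : Finset (Fin (2 * m)) => 2 * S.card = 2 * m).card
        = m.centralBinom := by
      rw [Finset.filter_congr (q := fun S : Finset (Fin (2 * m)) => S.card = m)
        (by intros; omega), Finset.univ_filter_card_eq, Finset.card_powersetCard,
        Finset.card_univ, Fintype.card_fin, Nat.centralBinom]
    rw [hcard, pow_mul]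
    exact centralBinom_sq_mul_le m
  · rw [Finset.filter_false_of_mem (by intros; omega)]
    simp

theorem tendsto_card_tie_div :
    Filter.Tendsto
      (fun n : ℕ =>
        ((Finset.univ.filter fun S : Finset (Fin n) => 2 * S.card = n).card : ℝ) / 2 ^ n)
      Filter.atTop (nhds 0) := by
  have hsqrt : Filter.Tendsto (fun n : ℕ => √(1 / ((n : ℝ) + 1))) Filter.atTop (nhds 0) := by
    simpa using (tendsto_one_div_add_atTop_nhds_zero_nat (𝕜 := ℝ)).sqrt
  refine squeeze_zero (fun n => by positivity) (fun n => ?_) hsqrt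
  refine Real.le_sqrt_of_sq_le ?_
  rw [div_pow, div_le_div_iff₀ (by positivity) (by positivity), one_mul, ← pow_mul, mul_comm n,
    pow_mul]
  norm_num
  exact_mod_cast card_tie_sq_mul_le n

theorem tendsto_card_majority_div :
    Filter.Tendsto
      (fun n : ℕ =>
        ((Finset.univ.filter fun S : Finset (Fin n) => n < 2 * S.card).card : ℝ) / 2 ^ n)
      Filter.atTop (nhds (1 / 2)) := by
  have h := (tendsto_card_tie_div.const_sub 1).div_const 2
  rw [sub_zero] at h
  refine h.congr fun n => ?_
  have hn := congrArg (Nat.cast (R := ℝ)) (two_mul_card_majority_add_card_tie n)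
  push_cast at hn
  field_simp
  linarith

/-- Replacing a set by its complement when `e` is false. -/
def setIffEquiv (α : Type*) (e : Bool) : Set α ≃ Set α where
  toFun S := {x | x ∈ S ↔ e = true}
  invFun S := {x | x ∈ S ↔ e = true}
  left_inv S := by cases e <;> ext <;> simp
  right_inv S := by cases e <;> ext <;> simp

theorem card_subtype_majority (n : ℕ) (e : Bool) :
    Nat.card {S : Set (Fin n) // n < 2 * Nat.card {x : Fin n // x ∈ S ↔ e = true}}
      = (Finset.univ.filter fun S : Finset (Fin n) => n < 2 * S.card).card := by
  rw [← Fintype.card_subtype, ← Nat.card_eq_fintype_card]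
  symm
  refine Nat.card_congr
    ((Fintype.finsetEquivSet.trans (setIffEquiv (Fin n) e).symm).subtypeEquiv fun S => ?_)
  have hS : Nat.card {x : Fin n //
      x ∈ (Fintype.finsetEquivSet.trans (setIffEquiv (Fin n) e).symm) S ↔ e = true}
      = S.card := by
    have h := (setIffEquiv (Fin n) e).apply_symm_apply (S : Set (Fin n))
    calc _ = Nat.card ((setIffEquiv (Fin n) e) ((setIffEquiv (Fin n) e).symm (S : Set (Fin n))))
          := rfl
      _ = S.card := by rw [h]; simp
  rw [hS]

theorem card_subtype_apply {ι β : Type*} [Fintype ι] [Finite β] (i : ι)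
    (p : β → Prop) :
    Nat.card {f : ι → β // p (f i)} = Nat.card {b // p b} * Nat.card β ^ (Fintype.card ι - 1) := by
  classical
  rw [Nat.card_congr (((Equiv.funSplitAt i β).subtypeEquiv
    (q := fun s => p s.1) fun f => by simp [Equiv.funSplitAt]).trans
      Equiv.prodSubtypeFstEquivSubtypeProd), Nat.card_prod, Nat.card_fun]
  simp [Fintype.card_subtype_compl]

/-- For `L = {U_1,…,U_k}` and a basic property given by a 1-subsequence (i.e. `U_i(x)` or
`¬U_i(x)`), the typicality degree is `1/2`: the fraction of `k`-tuples `W` of subsets of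
`Fin n` with `2·|W_i^e| > n` tends to `1/2`. In particular the 0-1 law for typicality
degrees fails for relational languages with unary predicates. -/
theorem stmt3 (k : ℕ) (hk : 1 ≤ k) (i : Fin k) (e : Bool) :
    Filter.Tendsto
      (fun n : ℕ =>
        (Nat.card {W : Fin k → Set (Fin n) //
            n < 2 * Nat.card {x : Fin n // x ∈ W i ↔ e = true}} : ℝ)
          / ((2 : ℝ) ^ n) ^ k)
      Filter.atTop (nhds (1 / 2)) := by
  refine tendsto_card_majority_div.congr fun n => ?_
  rw [card_subtype_apply i
    fun S : Set (Fin n) => n < 2 * Nat.card {x : Fin n // x ∈ S ↔ e = true},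
    card_subtype_majority]
  obtain ⟨k, rfl⟩ := Nat.exists_eq_add_of_le' hk
  simp only [Nat.card_eq_fintype_card, Fintype.card_set, Fintype.card_fin, Nat.add_sub_cancel]
  push_cast
  rw [pow_succ]
  field_simp
end

section
/- The limit, as n → ∞, of the ratio |{f : Fin n → Fin n | 2·|{x : f x = x}| > n}| / n^n equals 0. That is, for the language L = {F} with one unary function symbol, the property F(x) = x has typicality degree d(F(x)=x : typ) = 0. -/
/-- The average number of fixed points of a self-map of a nonempty finite type is one. -/
theorem sum_card_fixedPoints {α : Type*} [Fintype α] [DecidableEq α] [Nonempty α] :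
    ∑ f : α → α, (Finset.univ.filter fun x => f x = x).card
      = Fintype.card α ^ Fintype.card α := by
  have key (x : α) : (Finset.univ.filter fun f : α → α => f x = x).card
      = Fintype.card α ^ (Fintype.card α - 1) := by
    simpa using Fintype.card_filter_piFinset_const_eq_of_mem
      (Finset.univ : Finset α) x (Finset.mem_univ x)
  simp_rw [Finset.card_filter]
  rw [Finset.sum_comm]
  simp_rw [← Finset.card_filter, key]
  rw [Finset.sum_const, smul_eq_mul, Finset.card_univ]
  exact mul_pow_sub_one Fintype.card_ne_zero _

/-- For the language `L = {F}` with one unary function symbol, the property `F(x) = x`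
has typicality degree `0`. -/
theorem stmt11 :
    Filter.Tendsto
      (fun n : ℕ =>
        (Nat.card {f : Fin n → Fin n // n < 2 * Nat.card {x : Fin n // f x = x}} : ℝ)
          / (n : ℝ) ^ n)
      Filter.atTop (nhds 0) := by
  have markov (n : ℕ) [NeZero n] :
      Nat.card {f : Fin n → Fin n // n < 2 * Nat.card {x : Fin n // f x = x}} * n
        ≤ 2 * n ^ n := by
    simp_rw [Nat.card_eq_fintype_card, Fintype.card_subtype]
    calc _ ≤ ∑ f : Fin n → Fin n with n < 2 * (Finset.univ.filter fun x => f x = x).card,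
          2 * (Finset.univ.filter fun x => f x = x).card :=
          Finset.card_nsmul_le_sum _ _ n fun f hf => (Finset.mem_filter.mp hf).2.le
      _ ≤ ∑ f : Fin n → Fin n, 2 * (Finset.univ.filter fun x => f x = x).card :=
          Finset.sum_le_sum_of_subset (Finset.filter_subset _ _)
      _ = 2 * n ^ n := by rw [← Finset.mul_sum, sum_card_fixedPoints, Fintype.card_fin]
  refine squeeze_zero' (.of_forall fun n => by positivity) ?_
    (tendsto_const_div_atTop_nhds_zero_nat (2 : ℝ))
  filter_upwards [Filter.eventually_gt_atTop 0] with n hn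
  rw [div_le_div_iff₀ (by positivity) (by positivity)]
  have : NeZero n := ⟨hn.ne'⟩
  exact_mod_cast markov n
end

section
/- Each of the following fractions, taken over all 2^{C(2n,2)} simple graphs G on the vertex set Fin (2n), tends to 0 as n → ∞: (a) the fraction of G with exactly n isolated vertices; (b) the fraction of G with exactly n vertices adjacent to every other vertex; (c) for each fixed k ≥ 1, the fraction of G with exactly n vertices of degree exactly k. That is, the graph properties φ_none(x), φ_all(x), and φ_k(x) for every k ≥ 1 are all regular. -/
/-- The graph obtained from `G` by making `T` the neighbourhood of `x`. -/
def SimpleGraph.replaceNeighbors {V : Type*} (G : SimpleGraph V) (x : V)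
    (T : Set {y : V // y ≠ x}) : SimpleGraph V where
  Adj a b := (a ≠ x ∧ b ≠ x ∧ G.Adj a b) ∨ (a = x ∧ b ∈ Subtype.val '' T) ∨
    (b = x ∧ a ∈ Subtype.val '' T)
  symm := ⟨fun a b h => by
    have := G.adj_comm a b
    tauto⟩
  loopless := ⟨fun a h => by
    rcases h with ⟨-, -, h⟩ | ⟨rfl, ⟨y, hy⟩, -, h⟩ | ⟨rfl, ⟨y, hy⟩, -, h⟩
    · exact G.irrefl h
    · exact hy h
    · exact hy h⟩

theorem SimpleGraph.replaceNeighbors_adj_left {V : Type*} (G : SimpleGraph V) (x : V)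
    (T : Set {y : V // y ≠ x}) (y : {y : V // y ≠ x}) :
    (G.replaceNeighbors x T).Adj x y ↔ y ∈ T := by
  have := y.2
  simp [SimpleGraph.replaceNeighbors, this]

theorem SimpleGraph.replaceNeighbors_adj_of_ne {V : Type*} (G : SimpleGraph V) (x : V)
    (T : Set {y : V // y ≠ x}) {a b : V} (ha : a ≠ x) (hb : b ≠ x) :
    (G.replaceNeighbors x T).Adj a b ↔ G.Adj a b := by
  simp [SimpleGraph.replaceNeighbors, ha, hb]

theorem SimpleGraph.natCard_le_two_pow (V : Type*) [Finite V] :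
    Nat.card (SimpleGraph V) ≤ 2 ^ (Nat.card V).choose 2 := by
  classical
  have := Fintype.ofFinite V
  have hinj : Function.Injective
      (fun (G : SimpleGraph V) => ({e | e.1 ∈ G.edgeSet} : Set {e : Sym2 V // ¬ e.IsDiag})) := by
    intro G H h
    rw [← SimpleGraph.edgeSet_inj]
    ext e
    by_cases he : e.IsDiag
    · exact iff_of_false (fun h' => G.not_isDiag_of_mem_edgeSet h' he)
        (fun h' => H.not_isDiag_of_mem_edgeSet h' he)
    · exact Set.ext_iff.1 h ⟨e, he⟩
  refine (Nat.card_le_card_of_injective _ hinj).trans_eq ?_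
  rw [Nat.card_eq_fintype_card, Fintype.card_set, Sym2.card_subtype_not_diag,
    Nat.card_eq_fintype_card]

theorem SimpleGraph.natCard_neighborSet_eq_mul_le {V : Type*} [Finite V] (x : V) (S : Set V) :
    Nat.card {G : SimpleGraph V // G.neighborSet x = S} * 2 ^ (Nat.card V - 1) ≤
      Nat.card (SimpleGraph V) := by
  classical
  have := Fintype.ofFinite V
  have hcard : Nat.card (Set {y : V // y ≠ x}) = 2 ^ (Nat.card V - 1) := by
    rw [Nat.card_eq_fintype_card, Fintype.card_set, Fintype.card_subtype_compl,
      Fintype.card_subtype_eq, Nat.card_eq_fintype_card]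
  rw [← hcard, ← Nat.card_prod]
  refine Nat.card_le_card_of_injective
    (fun p : {G : SimpleGraph V // G.neighborSet x = S} × Set {y : V // y ≠ x} =>
      p.1.1.replaceNeighbors x p.2) ?_
  rintro ⟨⟨G, hG⟩, T⟩ ⟨⟨H, hH⟩, U⟩ h
  dsimp only at h
  have hTU : T = U := by
    ext y
    rw [← G.replaceNeighbors_adj_left x T y, h, H.replaceNeighbors_adj_left]
  have hN : ∀ y, G.Adj x y ↔ H.Adj x y := fun y => Set.ext_iff.1 (hG.trans hH.symm) y
  have hGH : G = H := by
    ext a b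
    by_cases ha : a = x
    · rw [ha, hN]
    by_cases hb : b = x
    · rw [hb, G.adj_comm, H.adj_comm, hN]
    rw [← G.replaceNeighbors_adj_of_ne x T ha hb, h, H.replaceNeighbors_adj_of_ne x U ha hb]
  subst hTU hGH
  rfl

theorem SimpleGraph.natCard_neighborSet_mem_mul_le {V : Type*} [Finite V] (x : V)
    (F : Set (Set V)) :
    Nat.card {G : SimpleGraph V // G.neighborSet x ∈ F} * 2 ^ (Nat.card V - 1) ≤
      F.ncard * Nat.card (SimpleGraph V) := by
  classical
  have := Fintype.ofFinite V
  have e : {G : SimpleGraph V // G.neighborSet x ∈ F} ≃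
      Σ S : F, {G : SimpleGraph V // G.neighborSet x = S} :=
    { toFun := fun G => ⟨⟨_, G.2⟩, G.1, rfl⟩
      invFun := fun p => ⟨p.2.1, by rw [p.2.2]; exact p.1.2⟩
      left_inv := fun G => rfl
      right_inv := by rintro ⟨⟨_, _⟩, ⟨G, hG⟩⟩; cases hG; rfl }
  rw [Nat.card_congr e, Nat.card_sigma, Finset.sum_mul, ← Nat.card_coe_set_eq,
    Nat.card_eq_fintype_card (α := F), ← smul_eq_mul (Fintype.card F), ← Finset.card_univ]
  exact Finset.sum_le_card_nsmul _ _ _ fun S _ => natCard_neighborSet_eq_mul_le x S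

/-- Markov's inequality for the number of vertices whose neighbourhood lies in a prescribed
family. -/
theorem SimpleGraph.mul_natCard_mul_two_pow_le {V : Type*} [Finite V] (F : V → Set (Set V))
    {m M : ℕ} (hF : ∀ x, (F x).ncard ≤ M) :
    m * Nat.card {G : SimpleGraph V // Nat.card {x // G.neighborSet x ∈ F x} = m} *
      2 ^ (Nat.card V - 1) ≤ Nat.card V * (M * Nat.card (SimpleGraph V)) := by
  classical
  have := Fintype.ofFinite V
  have hinc : m * Nat.card {G : SimpleGraph V // Nat.card {x // G.neighborSet x ∈ F x} = m} ≤
      ∑ x : V, Nat.card {G : SimpleGraph V // G.neighborSet x ∈ F x} := by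
    calc _ = Nat.card (Σ G : {G : SimpleGraph V // Nat.card {x // G.neighborSet x ∈ F x} = m},
          {x // G.1.neighborSet x ∈ F x}) := by
          rw [Nat.card_sigma, Finset.sum_congr rfl fun G _ => G.2]
          simp [mul_comm]
      _ ≤ Nat.card (Σ x : V, {G : SimpleGraph V // G.neighborSet x ∈ F x}) := by
          refine Nat.card_le_card_of_injective (fun p => ⟨p.2.1, p.1.1, p.2.2⟩) ?_
          rintro ⟨⟨G, hG⟩, x, hx⟩ ⟨⟨H, hH⟩, y, hy⟩ h
          simp only [Sigma.mk.injEq] at h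
          obtain ⟨rfl, h⟩ := h
          simp only [heq_eq_eq, Subtype.mk.injEq] at h
          subst h
          rfl
      _ = _ := Nat.card_sigma
  refine (Nat.mul_le_mul_right _ hinc).trans ?_
  rw [Finset.sum_mul, Nat.card_eq_fintype_card (α := V), ← Finset.card_univ, ← smul_eq_mul]
  exact Finset.sum_le_card_nsmul _ _ _ fun x _ =>
    (Finset.card_univ (α := V) ▸ Nat.card_eq_fintype_card (α := V) ▸
      natCard_neighborSet_mem_mul_le x (F x)).trans (Nat.mul_le_mul_right _ (hF x))

theorem SimpleGraph.natCard_neutral_div_le {n M : ℕ} (hn : 1 ≤ n)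
    (F : Fin (2 * n) → Set (Set (Fin (2 * n)))) (hF : ∀ x, (F x).ncard ≤ M) :
    (Nat.card {G : SimpleGraph (Fin (2 * n)) //
        Nat.card {x // G.neighborSet x ∈ F x} = n} : ℝ) / 2 ^ (2 * n).choose 2 ≤
      4 * (M / 4 ^ n) := by
  have h1 := SimpleGraph.mul_natCard_mul_two_pow_le F (m := n) hF
  have h2 := SimpleGraph.natCard_le_two_pow (Fin (2 * n))
  rw [Nat.card_fin] at h1 h2
  generalize Nat.card {G : SimpleGraph (Fin (2 * n)) //
    Nat.card {x // G.neighborSet x ∈ F x} = n} = c at *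
  have h3 : c * 4 ^ n ≤ 4 * M * 2 ^ (2 * n).choose 2 := by
    have h4 : (4 : ℕ) ^ n = 2 * 2 ^ (2 * n - 1) := by
      rw [← pow_succ', Nat.sub_add_cancel (by omega), pow_mul]
      norm_num
    refine Nat.le_of_mul_le_mul_left ?_ hn
    calc n * (c * 4 ^ n) = 2 * (n * c * 2 ^ (2 * n - 1)) := by rw [h4]; ring
      _ ≤ 2 * (2 * n * (M * 2 ^ (2 * n).choose 2)) := by
          refine Nat.mul_le_mul_left _ (h1.trans ?_)
          gcongr
      _ = _ := by ring
  rw [← mul_div_assoc, div_le_div_iff₀ (by positivity) (by positivity)]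
  exact_mod_cast h3

theorem SimpleGraph.tendsto_natCard_neutral_div (k : ℕ)
    (F : ∀ n, Fin (2 * n) → Set (Set (Fin (2 * n))))
    (hF : ∀ n x, (F n x).ncard ≤ (2 * n) ^ k) :
    Filter.Tendsto
      (fun n : ℕ => (Nat.card {G : SimpleGraph (Fin (2 * n)) //
        Nat.card {x // G.neighborSet x ∈ F n x} = n} : ℝ) / (2 : ℝ) ^ (2 * n).choose 2)
      Filter.atTop (nhds 0) := by
  have hlim := (tendsto_pow_const_div_const_pow_of_one_lt k
    (show (1 : ℝ) < 4 by norm_num)).const_mul (4 * 2 ^ k)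
  rw [mul_zero] at hlim
  refine squeeze_zero' (Filter.Eventually.of_forall fun n => by positivity) ?_ hlim
  filter_upwards [Filter.eventually_ge_atTop 1] with n hn
  refine (natCard_neutral_div_le hn (F n) (hF n)).trans_eq ?_
  push_cast
  ring

theorem Set.ncard_setOf_ncard_eq_le (α : Type*) [Finite α] (k : ℕ) :
    {S : Set α | S.ncard = k}.ncard ≤ Nat.card α ^ k := by
  have hsub : {S : Set α | S.ncard = k} ⊆ Set.range (fun f : Fin k → α => Set.range f) := by
    intro S hS
    have e := Finite.equivFinOfCardEq (α := S) ((Nat.card_coe_set_eq S).trans hS)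
    refine ⟨fun i => (e.symm i : α), ?_⟩
    ext y
    exact ⟨fun ⟨i, hi⟩ => hi ▸ (e.symm i).2, fun hy => ⟨e ⟨y, hy⟩, by simp⟩⟩
  refine (Set.ncard_le_ncard hsub).trans ?_
  rw [← Nat.card_coe_set_eq]
  refine (Finite.card_range_le _).trans_eq ?_
  rw [Nat.card_fun, Nat.card_fin]


/-- The graph properties `φ_none(x)` (isolated), `φ_all(x)` (adjacent to every other
vertex), and `φ_k(x)` (degree exactly `k`) for every `k ≥ 1` are all regular: the
fraction of simple graphs on `Fin (2n)` in which exactly `n` vertices satisfy the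
property tends to `0` as `n → ∞`. -/
theorem stmt18 :
    Filter.Tendsto
      (fun n : ℕ =>
        (Nat.card {G : SimpleGraph (Fin (2 * n)) //
            Nat.card {x : Fin (2 * n) // ∀ y, ¬ G.Adj x y} = n} : ℝ)
          / (2 : ℝ) ^ (2 * n).choose 2)
      Filter.atTop (nhds 0) ∧
    Filter.Tendsto
      (fun n : ℕ =>
        (Nat.card {G : SimpleGraph (Fin (2 * n)) //
            Nat.card {x : Fin (2 * n) // ∀ y, y ≠ x → G.Adj x y} = n} : ℝ)
          / (2 : ℝ) ^ (2 * n).choose 2)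
      Filter.atTop (nhds 0) ∧
    ∀ k : ℕ, 1 ≤ k →
      Filter.Tendsto
        (fun n : ℕ =>
          (Nat.card {G : SimpleGraph (Fin (2 * n)) //
              Nat.card {x : Fin (2 * n) //
                Nat.card {y : Fin (2 * n) // G.Adj x y} = k} = n} : ℝ)
            / (2 : ℝ) ^ (2 * n).choose 2)
        Filter.atTop (nhds 0) := by
  refine ⟨?_, ?_, fun k _ => ?_⟩
  · convert SimpleGraph.tendsto_natCard_neutral_div 0 (fun n _ => {∅}) (by simp) using 10
    simp [SimpleGraph.neighborSet, Set.eq_empty_iff_forall_notMem]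
  · convert SimpleGraph.tendsto_natCard_neutral_div 0 (fun n x => {{x}ᶜ}) (by simp) using 10 with n G
    funext x
    refine propext ⟨fun h => ?_, fun h y hy => ?_⟩
    · ext y
      exact ⟨fun hy => hy.ne', fun hy => h y hy⟩
    · exact (Set.ext_iff.1 h y).2 hy
  · convert SimpleGraph.tendsto_natCard_neutral_div k (fun n _ => {S | S.ncard = k})
      (fun n _ => by simpa using Set.ncard_setOf_ncard_eq_le (Fin (2 * n)) k) using 10
    rfl
end
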